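/- The map ℕ → End_R(V), n ↦ [n]_{τ,V}, extends uniquely to a continuous map ℤ_p → End_R(V), where ℕ is viewed as a dense subset of ℤ_p and End_R(V) carries the m_R-adic topology. Concretely: for every a ∈ ℤ_p and every sequence (a_s)_{s≥0} of natural numbers with a_s ≡ a (mod p^s) for all s, the sequence ([a_s]_{τ,V})_{s≥0} converges in End_R(V) for the m_R-adic topology, and its limit depends only on a (not on the chosen sequence); the resulting map ℤ_p → End_R(V) is continuous and extends n ↦ [n]_{τ,V}. -/

import Mathlib

open IsLocalRing

/-- `[n]_{τ,V} = Id + τ + τ² + ⋯ + τ^{n-1}`. -/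
noncomputable def brack {R V : Type} [CommRing R] [AddCommGroup V] [Module R V]
    (τ : Module.End R V) (n : ℕ) : Module.End R V :=
  ∑ i ∈ Finset.range n, τ ^ i

section Helpers

lemma aux_pi_mem {R M : Type} [CommRing R] [AddCommGroup M] [Module R M] (I : Ideal R) {n : ℕ}
    (x : Fin n → M) (h : ∀ i, x i ∈ I • (⊤ : Submodule R M)) :
    x ∈ I • (⊤ : Submodule R (Fin n → M)) := by
  classical
  have hx : x = ∑ i, LinearMap.single R (fun _ : Fin n => M) i (x i) := by
    simp [Finset.univ_sum_single]
  rw [hx]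
  refine Submodule.sum_mem _ fun i _ => ?_
  have h1 : (I • (⊤ : Submodule R M)).map (LinearMap.single R (fun _ : Fin n => M) i)
      ≤ I • (⊤ : Submodule R (Fin n → M)) := by
    rw [Submodule.map_smul'']
    exact Submodule.smul_mono le_rfl le_top
  exact h1 (Submodule.mem_map_of_mem (h i))

lemma aux_precomplete_pi {R : Type} [CommRing R] (I : Ideal R) [IsPrecomplete I R] (n : ℕ) :
    IsPrecomplete I (Fin n → R) := by
  refine ⟨fun f hf => ?_⟩
  have key : ∀ i : Fin n, ∃ L : R, ∀ m, f m i ≡ L [SMOD (I ^ m • ⊤ : Submodule R R)] := by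
    intro i
    refine IsPrecomplete.prec ‹_› (f := fun m => f m i) fun {a b} hab => ?_
    have h1 := SModEq.sub_mem.1 (hf hab)
    rw [SModEq.sub_mem]
    have h2 : (I ^ a • (⊤ : Submodule R (Fin n → R))).map (LinearMap.proj i)
        ≤ I ^ a • (⊤ : Submodule R R) := by
      rw [Submodule.map_smul'']
      exact Submodule.smul_mono le_rfl le_top
    exact h2 (Submodule.mem_map_of_mem h1)
  choose L hL using key
  refine ⟨L, fun m => ?_⟩
  rw [SModEq.sub_mem]
  exact aux_pi_mem _ _ fun i => SModEq.sub_mem.1 (hL i m)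

lemma aux_precomplete {R M : Type} [CommRing R] (I : Ideal R) [IsPrecomplete I R]
    [AddCommGroup M] [Module R M] [Module.Finite R M] : IsPrecomplete I M := by
  obtain ⟨n, π, hπ⟩ := Module.Finite.exists_fin' R M
  have := aux_precomplete_pi I n
  rw [← AdicCompletion.of_surjective_iff]
  intro x
  obtain ⟨y, rfl⟩ := AdicCompletion.map_surjective I hπ x
  obtain ⟨z, rfl⟩ := AdicCompletion.of_surjective I (Fin n → R) y
  exact ⟨π z, (AdicCompletion.map_of I π z).symm⟩

lemma aux_end {R V : Type} [CommRing R] [IsNoetherianRing R] (I : Ideal R)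
    [AddCommGroup V] [Module R V] [Module.Finite R V] :
    Module.Finite R (Module.End R V) ∧ ∀ j : ℕ, ∃ k : ℕ, ∀ φ : Module.End R V,
      (∀ v, φ v ∈ I ^ k • (⊤ : Submodule R V)) →
        φ ∈ I ^ j • (⊤ : Submodule R (Module.End R V)) := by
  obtain ⟨n, π, hπ⟩ := Module.Finite.exists_fin' R V
  let e : Module.End R V →ₗ[R] (Fin n → V) :=
    LinearMap.pi fun i => LinearMap.applyₗ (π (Pi.single i 1))
  have he : Function.Injective e := by
    intro φ ψ h
    have h1 : φ ∘ₗ π = ψ ∘ₗ π := by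
      refine LinearMap.pi_ext' fun i => LinearMap.ext_ring ?_
      exact congrFun h i
    exact LinearMap.cancel_right hπ |>.1 h1
  refine ⟨Module.Finite.of_injective e he, fun j => ?_⟩
  obtain ⟨k, hk⟩ := I.exists_pow_inf_eq_pow_smul (LinearMap.range e)
  refine ⟨j + k, fun φ hφ => ?_⟩
  have h1 : e φ ∈ I ^ (j + k) • (⊤ : Submodule R (Fin n → V)) ⊓ LinearMap.range e :=
    ⟨aux_pi_mem _ _ fun i => hφ _, ⟨φ, rfl⟩⟩
  rw [hk _ (Nat.le_add_left _ _), Nat.add_sub_cancel] at h1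
  have h2 : e φ ∈ (I ^ j • (⊤ : Submodule R (Module.End R V))).map e := by
    rw [Submodule.map_smul'', Submodule.map_top]
    exact Submodule.smul_mono le_rfl inf_le_right h1
  obtain ⟨ψ, hψ, hh⟩ := h2
  exact he hh ▸ hψ

lemma aux_map_mem {R V : Type} [CommRing R] (I : Ideal R) [AddCommGroup V] [Module R V]
    (φ : Module.End R V) (v : V) (hv : v ∈ I • (⊤ : Submodule R V)) :
    φ v ∈ I • (⊤ : Submodule R V) := by
  have h2 : (I • (⊤ : Submodule R V)).map φ ≤ I • (⊤ : Submodule R V) := by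
    rw [Submodule.map_smul'']
    exact Submodule.smul_mono le_rfl le_top
  exact h2 (Submodule.mem_map_of_mem hv)

lemma aux_map_mem' {R V : Type} [CommRing R] (I J : Ideal R) [AddCommGroup V] [Module R V]
    (φ : Module.End R V) (h : ∀ v, φ v ∈ J • (⊤ : Submodule R V))
    (v : V) (hv : v ∈ I • (⊤ : Submodule R V)) :
    φ v ∈ (I * J) • (⊤ : Submodule R V) := by
  have h2 : (I • (⊤ : Submodule R V)).map φ ≤ (I * J) • (⊤ : Submodule R V) := by
    rw [Submodule.map_smul'', Submodule.mul_smul]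
    refine Submodule.smul_mono le_rfl ?_
    rintro _ ⟨w, -, rfl⟩
    exact h w
  exact h2 (Submodule.mem_map_of_mem hv)

lemma brack_add {R V : Type} [CommRing R] [AddCommGroup V] [Module R V]
    (τ : Module.End R V) (m n : ℕ) : brack τ (m + n) = brack τ m + τ ^ m * brack τ n := by
  simp [brack, Finset.sum_range_add, Finset.mul_sum, pow_add]

lemma brack_mul {R V : Type} [CommRing R] [AddCommGroup V] [Module R V]
    (τ : Module.End R V) (m n : ℕ) : brack τ (m * n) = brack (τ ^ m) n * brack τ m := by
  induction n with
  | zero => simp [brack]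
  | succ n ih =>
    rw [Nat.mul_succ, brack_add, ih]
    have : brack (τ ^ m) (n + 1) = brack (τ ^ m) n + τ ^ (m * n) := by
      simp [brack, Finset.sum_range_succ, pow_mul]
    rw [this, add_mul]

lemma aux_brack_pow {R V : Type} [CommRing R] [AddCommGroup V] [Module R V]
    (I : Ideal R) (p : ℕ) (hp : (p : R) ∈ I) (τ : Module.End R V) (n₀ : ℕ)
    (h : ∀ v : V, (τ ^ p ^ n₀ - 1) v ∈ I • (⊤ : Submodule R V)) (k : ℕ) :
    ∀ v, brack τ (p ^ (n₀ + k)) v ∈ I ^ k • (⊤ : Submodule R V) := by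
  induction k with
  | zero => intro v; simp
  | succ k ih =>
    intro v
    rw [← add_assoc, pow_succ p, brack_mul, pow_succ I, Module.End.mul_apply]
    refine aux_map_mem' _ _ _ (fun w => ?_) _ (ih v)
    have h1 : brack (τ ^ p ^ (n₀ + k)) p =
        ∑ i ∈ Finset.range p, ((τ ^ p ^ (n₀ + k)) ^ i - 1) + (p : Module.End R V) := by
      simp [brack]
    rw [h1, LinearMap.add_apply, LinearMap.sum_apply]
    refine Submodule.add_mem _ (Submodule.sum_mem _ fun i _ => ?_) ?_
    · rw [pow_add, pow_mul, ← pow_mul]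
      obtain ⟨c, hc⟩ := sub_one_dvd_pow_sub_one (τ ^ p ^ n₀) (p ^ k * i)
      rw [hc]
      exact h _
    · have : (p : Module.End R V) w = (p : R) • w := by
        rw [Module.End.natCast_apply, Nat.cast_smul_eq_nsmul]
      rw [this]
      exact Submodule.smul_mem_smul hp trivial

lemma aux_cauchy {R V : Type} [CommRing R] [AddCommGroup V] [Module R V]
    (I : Ideal R) (p : ℕ) (hp : (p : R) ∈ I) (τ : Module.End R V) (n₀ : ℕ)
    (h : ∀ v : V, (τ ^ p ^ n₀ - 1) v ∈ I • (⊤ : Submodule R V)) (k : ℕ) (m n : ℕ)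
    (hmn : m ≡ n [MOD p ^ (n₀ + k)]) (v : V) :
    (brack τ m - brack τ n) v ∈ I ^ k • (⊤ : Submodule R V) := by
  wlog hle : n ≤ m generalizing m n
  · have := this n m hmn.symm (by omega)
    rw [← neg_sub, LinearMap.neg_apply]
    exact Submodule.neg_mem _ this
  obtain ⟨c, hc⟩ := (Nat.modEq_iff_dvd' hle).1 hmn.symm
  obtain rfl : m = n + p ^ (n₀ + k) * c := by omega
  rw [brack_add, add_sub_cancel_left, brack_mul, ← mul_assoc, Module.End.mul_apply]
  exact aux_map_mem _ _ _ (aux_brack_pow I p hp τ n₀ h k v)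

lemma aux_modEq (p : ℕ) [Fact p.Prime] (a : ℤ_[p]) (N m n : ℕ)
    (hm : a - (m : ℤ_[p]) ∈ Ideal.span {(p : ℤ_[p]) ^ N})
    (hn : a - (n : ℤ_[p]) ∈ Ideal.span {(p : ℤ_[p]) ^ N}) : m ≡ n [MOD p ^ N] := by
  have h := Ideal.sub_mem _ hm hn
  rw [sub_sub_sub_cancel_left, Ideal.mem_span_singleton] at h
  rw [Nat.modEq_iff_dvd]
  have := (PadicInt.pow_p_dvd_int_iff (p := p) N ((n : ℤ) - m)).1 (by exact_mod_cast h)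
  exact_mod_cast this

lemma aux_span_mono (p : ℕ) [Fact p.Prime] {a : ℤ_[p]} {M N : ℕ} (h : N ≤ M)
    (ha : a ∈ Ideal.span {(p : ℤ_[p]) ^ M}) : a ∈ Ideal.span {(p : ℤ_[p]) ^ N} := by
  rw [Ideal.mem_span_singleton] at *
  exact (pow_dvd_pow _ h).trans ha

end Helpers

/-- Lemma 2.7: the map `n ↦ [n]_{τ,V}` extends uniquely to a continuous
map `ℤ_p → End_R(V)` (for the `m_R`-adic topology on `End_R(V)`): there is a map
`F : ℤ_p → End_R(V)` extending `n ↦ [n]_{τ,V}`, such that for every `a ∈ ℤ_p` and every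
sequence of naturals `a_s ≡ a (mod p^s)` the sequence `[a_s]_{τ,V}` converges
`m_R`-adically to `F a`, which is continuous, and which is the unique such map. -/
theorem brack_extends_to_padic
    (p : ℕ) [Fact p.Prime]
    (R : Type) [CommRing R] [IsLocalRing R] [IsNoetherianRing R]
    [Algebra ℤ_[p] R]
    [IsAdicComplete (maximalIdeal R) R]
    (hchar : (p : R) ∈ maximalIdeal R)
    (V : Type) [AddCommGroup V] [Module R V] [Module.Finite R V]
    (τ : Module.End R V) (hτ : IsUnit τ)
    (hwild : ∃ n₀ : ℕ, ∀ v : V,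
      (τ ^ p ^ n₀ - 1) v ∈ (maximalIdeal R) • (⊤ : Submodule R V)) :
    ∃ F : ℤ_[p] → Module.End R V,
      -- `F` extends `n ↦ [n]_{τ,V}`
      (∀ n : ℕ, F (n : ℤ_[p]) = brack τ n) ∧
      -- for every `a` and every sequence `a_s ≡ a (mod p^s)`, `[a_s]_{τ,V} → F a`
      -- `m_R`-adically (in particular the limit depends only on `a`)
      (∀ (a : ℤ_[p]) (as : ℕ → ℕ),
        (∀ s : ℕ, a - (as s : ℤ_[p]) ∈ Ideal.span {(p : ℤ_[p]) ^ s}) →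
        ∀ j : ℕ, ∃ S : ℕ, ∀ s ≥ S,
          brack τ (as s) - F a ∈
            (maximalIdeal R) ^ j • (⊤ : Submodule R (Module.End R V))) ∧
      -- `F` is continuous (`p`-adic to `m_R`-adic)
      (∀ (a : ℤ_[p]) (j : ℕ), ∃ s : ℕ, ∀ b : ℤ_[p],
        b - a ∈ Ideal.span {(p : ℤ_[p]) ^ s} →
          F b - F a ∈ (maximalIdeal R) ^ j • (⊤ : Submodule R (Module.End R V))) ∧
      -- uniqueness of the continuous extension
      (∀ F' : ℤ_[p] → Module.End R V,
        (∀ n : ℕ, F' (n : ℤ_[p]) = brack τ n) →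
        (∀ (a : ℤ_[p]) (j : ℕ), ∃ s : ℕ, ∀ b : ℤ_[p],
          b - a ∈ Ideal.span {(p : ℤ_[p]) ^ s} →
            F' b - F' a ∈ (maximalIdeal R) ^ j • (⊤ : Submodule R (Module.End R V))) →
        F' = F) := by
  obtain ⟨n₀, h₀⟩ := hwild
  obtain ⟨hfin, hAR⟩ := aux_end (R := R) (V := V) (maximalIdeal R)
  have hpre : IsPrecomplete (maximalIdeal R) (Module.End R V) := aux_precomplete _
  have hhaus : IsHausdorff (maximalIdeal R) (Module.End R V) := inferInstance
  have hsep : ∀ x y : Module.End R V,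
      (∀ j : ℕ, x - y ∈ (maximalIdeal R) ^ j • (⊤ : Submodule R (Module.End R V))) → x = y := by
    intro x y h
    refine (IsHausdorff.eq_iff_smodEq (I := maximalIdeal R)).2 fun j => ?_
    exact SModEq.sub_mem.2 (h j)
  have hC : ∀ j : ℕ, ∃ N : ℕ, ∀ m n : ℕ, m ≡ n [MOD p ^ N] →
      brack τ m - brack τ n ∈ (maximalIdeal R) ^ j • (⊤ : Submodule R (Module.End R V)) := by
    intro j
    obtain ⟨k, hk⟩ := hAR j
    exact ⟨n₀ + k, fun m n hmn => hk _ (aux_cauchy _ p hchar τ n₀ h₀ k m n hmn)⟩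
  choose N hN using hC
  have hlim : ∀ a : ℤ_[p], ∃ L : Module.End R V, ∀ (j n : ℕ),
      a - (n : ℤ_[p]) ∈ Ideal.span {(p : ℤ_[p]) ^ N j} →
      brack τ n - L ∈ (maximalIdeal R) ^ j • (⊤ : Submodule R (Module.End R V)) := by
    intro a
    let M : ℕ → ℕ := fun j => ∑ i ∈ Finset.range (j + 1), N i
    have hM : ∀ i j, i ≤ j → N i ≤ M j := fun i j hij =>
      Finset.single_le_sum (f := N) (fun _ _ => Nat.zero_le _)
        (Finset.mem_range.2 (Nat.lt_succ_of_le hij))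
    have happ : ∀ i j, i ≤ j →
        a - (a.appr (M j) : ℤ_[p]) ∈ Ideal.span {(p : ℤ_[p]) ^ N i} := fun i j hij =>
      aux_span_mono p (hM i j hij) (PadicInt.appr_spec (M j) a)
    obtain ⟨L, hL⟩ := IsPrecomplete.prec hpre (f := fun j => brack τ (a.appr (M j)))
      (fun {i j} hij => SModEq.sub_mem.2
        (hN i _ _ (aux_modEq p a _ _ _ (happ i i le_rfl) (happ i j hij))))
    refine ⟨L, fun j n hn => ?_⟩
    have h1 := hN j _ _ (aux_modEq p a _ _ _ hn (happ j j le_rfl))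
    have h2 := SModEq.sub_mem.1 (hL j)
    simpa using Submodule.add_mem _ h1 h2
  choose F hF using hlim
  refine ⟨F, fun n => ?_, fun a as has j => ⟨N j, fun s hs => ?_⟩, fun a j => ⟨N j, fun b hb => ?_⟩,
    fun F' h1 h2 => funext fun a => ?_⟩
  · refine (hsep _ _ fun j => hF n j n ?_).symm
    simp
  · exact hF a j _ (aux_span_mono p hs (has s))
  · have hb' := PadicInt.appr_spec (N j) b
    have ha' : a - (b.appr (N j) : ℤ_[p]) ∈ Ideal.span {(p : ℤ_[p]) ^ N j} := by
      simpa using Ideal.sub_mem _ hb' hb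
    simpa using Submodule.sub_mem _ (hF a j _ ha') (hF b j _ hb')
  · refine hsep _ _ fun j => ?_
    obtain ⟨s, hs⟩ := h2 a j
    have happ := PadicInt.appr_spec (max s (N j)) a
    have e1 := hF a j _ (aux_span_mono p (le_max_right s (N j)) happ)
    have e2 := hs (a.appr (max s (N j))) (by
      have := Ideal.neg_mem_iff _ |>.2 (aux_span_mono p (le_max_left s (N j)) happ)
      simpa using this)
    rw [h1] at e2
    simpa using Submodule.sub_mem _ e1 e2
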